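/- Let G be a binary SSG (every vertex of V_MAX has outdegree exactly 2). If σ and σ' are MAX strategies with equal switch sets S_σ = S_{σ'}, then v_σ = v_{σ'} and σ(x) = σ'(x) for every x ∈ S_σ. -/

import Mathlib

open scoped BigOperators

instance : Fact ((0:ℝ) ≤ 1) := ⟨zero_le_one⟩

/-- A simple stochastic game on a finite vertex set `V`. -/
structure SSG (V : Type*) [Fintype V] [DecidableEq V] where
  /-- MAX vertices -/
  VMax : Finset V
  /-- MIN vertices -/
  VMin : Finset V
  /-- random vertices -/
  VR : Finset V
  /-- sink vertices -/
  VS : Finset V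
  cover : ∀ x : V, x ∈ VMax ∨ x ∈ VMin ∨ x ∈ VR ∨ x ∈ VS
  disjMaxMin : Disjoint VMax VMin
  disjMaxR : Disjoint VMax VR
  disjMaxS : Disjoint VMax VS
  disjMinR : Disjoint VMin VR
  disjMinS : Disjoint VMin VS
  disjRS : Disjoint VR VS
  /-- out-neighbourhood: `y ∈ succ x` iff `(x,y)` is an edge -/
  succ : V → Finset V
  outMax : ∀ x ∈ VMax, 2 ≤ (succ x).card
  outMin : ∀ x ∈ VMin, 2 ≤ (succ x).card
  outR : ∀ x ∈ VR, 1 ≤ (succ x).card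
  /-- transition probabilities at random vertices -/
  prob : V → V → ℝ
  prob_nonneg : ∀ x y, 0 ≤ prob x y
  prob_support : ∀ x ∈ VR, ∀ y, y ∉ succ x → prob x y = 0
  prob_sum : ∀ x ∈ VR, (∑ y, prob x y) = 1
  /-- values of the sinks -/
  val : V → ℝ
  val_mem : ∀ x ∈ VS, val x ∈ Set.Icc (0:ℝ) 1

namespace SSG

variable {V : Type*} [Fintype V] [DecidableEq V]

/-- A positional MAX strategy: a choice of an out-neighbour at every MAX vertex
(normalised to the identity away from `VMax`). -/
structure MaxStrategy (G : SSG V) where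
  toFun : V → V
  mem_succ : ∀ x ∈ G.VMax, toFun x ∈ G.succ x
  eq_id : ∀ x ∉ G.VMax, toFun x = x

/-- A positional MIN strategy. -/
structure MinStrategy (G : SSG V) where
  toFun : V → V
  mem_succ : ∀ x ∈ G.VMin, toFun x ∈ G.succ x
  eq_id : ∀ x ∉ G.VMin, toFun x = x

/-- The one-step (monotone) operator on value vectors associated with `(σ,τ)`. -/
noncomputable def F (G : SSG V) (σ : G.MaxStrategy) (τ : G.MinStrategy)
    (w : V → unitInterval) (x : V) : unitInterval :=
  if _hM : x ∈ G.VMax then w (σ.toFun x)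
  else if _hN : x ∈ G.VMin then w (τ.toFun x)
  else if hR : x ∈ G.VR then
    ⟨∑ y, G.prob x y * (w y : ℝ), by
      constructor
      · exact Finset.sum_nonneg fun y _ =>
          mul_nonneg (G.prob_nonneg x y) (w y).2.1
      · calc (∑ y, G.prob x y * (w y : ℝ)) ≤ ∑ y, G.prob x y :=
              Finset.sum_le_sum fun y _ =>
                mul_le_of_le_one_right (G.prob_nonneg x y) (w y).2.2
          _ = 1 := G.prob_sum x hR⟩
  else ⟨G.val x, G.val_mem x (by
    rcases G.cover x with h | h | h | h
    · exact absurd h _hM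
    · exact absurd h _hN
    · exact absurd h hR
    · exact h)⟩

/-- The value vector `v_{σ,τ}`: the least fixed point (à la Knaster–Tarski) of `F`. -/
noncomputable def value (G : SSG V) (σ : G.MaxStrategy) (τ : G.MinStrategy) :
    V → unitInterval :=
  sInf {w : V → unitInterval | G.F σ τ w ≤ w}

/-- `τ` is a best response to `σ`. -/
def IsBestResponse (G : SSG V) (σ : G.MaxStrategy) (τ : G.MinStrategy) : Prop :=
  ∀ τ' : G.MinStrategy, G.value σ τ ≤ G.value σ τ'

/-- `σ` is an optimal MAX strategy: `v_σ ≥ v_{σ'}` for every MAX strategy `σ'`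
(values being computed against best responses). -/
def IsOptimal (G : SSG V) (σ : G.MaxStrategy) : Prop :=
  ∀ τ : G.MinStrategy, G.IsBestResponse σ τ →
    ∀ σ' : G.MaxStrategy, ∀ τ' : G.MinStrategy, G.IsBestResponse σ' τ' →
      G.value σ' τ' ≤ G.value σ τ

/-- The switch set `S_σ` of `σ`, computed with a best response `τ` to `σ`. -/
def switchSet (G : SSG V) (σ : G.MaxStrategy) (τ : G.MinStrategy) : Set V :=
  {x | x ∈ G.VMax ∧ ∃ y ∈ G.succ x, G.value σ τ x < G.value σ τ y}

/-- `σ'` is a `σ`-switch (w.r.t. a best response `τ` to `σ`). -/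
def IsSwitch (G : SSG V) (σ : G.MaxStrategy) (τ : G.MinStrategy)
    (σ' : G.MaxStrategy) : Prop :=
  σ' ≠ σ ∧
  (∀ x ∈ G.VMax, x ∉ G.switchSet σ τ → σ'.toFun x = σ.toFun x) ∧
  (∀ x ∈ G.switchSet σ τ, σ'.toFun x ≠ σ.toFun x →
    G.value σ τ x < G.value σ τ (σ'.toFun x))

/-- `σ` agrees with `σ₀` on `T`. -/
def AgreesOn (G : SSG V) (T : Set V) (σ₀ σ : G.MaxStrategy) : Prop :=
  ∀ x ∈ T, σ.toFun x = σ₀.toFun x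

/-- `σ` is an optimal MAX strategy of the subgame `G_{|T[σ₀]}`: it agrees with `σ₀` on `T`
and its value vector dominates that of every MAX strategy of `G` agreeing with `σ₀` on `T`. -/
def IsOptimalOn (G : SSG V) (T : Set V) (σ₀ σ : G.MaxStrategy) : Prop :=
  G.AgreesOn T σ₀ σ ∧
  ∀ σ' : G.MaxStrategy, G.AgreesOn T σ₀ σ' →
    ∀ τ τ' : G.MinStrategy, G.IsBestResponse σ τ → G.IsBestResponse σ' τ' →
      G.value σ' τ' ≤ G.value σ τ

/-- `σ'` is a `(σ,T)`-super-switch (w.r.t. a best response `τ` to `σ`): it is obtained from an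
intermediate `σ`-switch `σ''` that only switches inside `T`, by taking an optimal strategy of
the subgame `G_{|T[σ'']}`. -/
def IsSuperSwitch (G : SSG V) (σ : G.MaxStrategy) (τ : G.MinStrategy)
    (T : Set V) (σ' : G.MaxStrategy) : Prop :=
  ∃ σ'' : G.MaxStrategy, G.IsSwitch σ τ σ'' ∧
    (∀ x ∈ G.VMax, x ∉ T → σ''.toFun x = σ.toFun x) ∧
    G.IsOptimalOn T σ'' σ'

/-- A binary SSG: every MAX vertex has outdegree exactly 2. -/
def Binary (G : SSG V) : Prop := ∀ x ∈ G.VMax, (G.succ x).card = 2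

/-- `σb` is the total switch `σ̄` of `σ` (in a binary SSG): it switches to the other
out-neighbour exactly on the switch set of `σ`. -/
def IsTotalSwitch (G : SSG V) (σ : G.MaxStrategy) (τ : G.MinStrategy)
    (σb : G.MaxStrategy) : Prop :=
  (∀ x ∈ G.switchSet σ τ, σb.toFun x ≠ σ.toFun x) ∧
  (∀ x ∈ G.VMax, x ∉ G.switchSet σ τ → σb.toFun x = σ.toFun x)

end SSG

namespace SSG

variable {V : Type*} [Fintype V] [DecidableEq V]

theorem F_mono_aux (G : SSG V) (σ : G.MaxStrategy) (τ : G.MinStrategy) :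
    Monotone (G.F σ τ) := by
  intro u w h x
  unfold F
  split_ifs
  · exact h _
  · exact h _
  · exact Subtype.mk_le_mk.2 (Finset.sum_le_sum fun y _ =>
      mul_le_mul_of_nonneg_left (h y) (G.prob_nonneg x y))
  · exact le_rfl

theorem value_fix (G : SSG V) (σ : G.MaxStrategy) (τ : G.MinStrategy) :
    G.F σ τ (G.value σ τ) = G.value σ τ :=
  OrderHom.map_lfp (⟨G.F σ τ, G.F_mono_aux σ τ⟩ : (V → unitInterval) →o (V → unitInterval))

theorem value_le_of (G : SSG V) (σ : G.MaxStrategy) (τ : G.MinStrategy)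
    (w : V → unitInterval) (h : G.F σ τ w ≤ w) : G.value σ τ ≤ w :=
  sInf_le h

theorem value_max (G : SSG V) (σ : G.MaxStrategy) (τ : G.MinStrategy) {x : V}
    (hx : x ∈ G.VMax) : G.value σ τ (σ.toFun x) = G.value σ τ x := by
  have := congrFun (G.value_fix σ τ) x
  simpa [F, hx] using this

theorem value_min (G : SSG V) (σ : G.MaxStrategy) (τ : G.MinStrategy) {x : V}
    (hx : x ∈ G.VMin) : G.value σ τ (τ.toFun x) = G.value σ τ x := by
  have h1 : x ∉ G.VMax := fun h => Finset.disjoint_left.1 G.disjMaxMin h hx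
  have := congrFun (G.value_fix σ τ) x
  simpa [F, hx, h1] using this

theorem value_rand (G : SSG V) (σ : G.MaxStrategy) (τ : G.MinStrategy) {x : V}
    (hx : x ∈ G.VR) : ∑ y, G.prob x y * (G.value σ τ y : ℝ) = G.value σ τ x := by
  have h1 : x ∉ G.VMax := fun h => Finset.disjoint_left.1 G.disjMaxR h hx
  have h2 : x ∉ G.VMin := fun h => Finset.disjoint_left.1 G.disjMinR h hx
  have := congrArg Subtype.val (congrFun (G.value_fix σ τ) x)
  simpa [F, hx, h1, h2] using this

theorem value_sink (G : SSG V) (σ : G.MaxStrategy) (τ : G.MinStrategy) {x : V}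
    (hx : x ∈ G.VS) : (G.value σ τ x : ℝ) = G.val x := by
  have h1 : x ∉ G.VMax := fun h => Finset.disjoint_left.1 G.disjMaxS h hx
  have h2 : x ∉ G.VMin := fun h => Finset.disjoint_left.1 G.disjMinS h hx
  have h3 : x ∉ G.VR := fun h => Finset.disjoint_left.1 G.disjRS h hx
  have := congrArg Subtype.val (congrFun (G.value_fix σ τ) x)
  simpa [F, h1, h2, h3] using this.symm

/-- Against a best response, no MIN vertex has a strictly better successor. -/
theorem br_min (G : SSG V) (σ : G.MaxStrategy) (τ : G.MinStrategy)
    (hbr : G.IsBestResponse σ τ) {x y : V} (hx : x ∈ G.VMin) (hy : y ∈ G.succ x) :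
    G.value σ τ x ≤ G.value σ τ y := by
  by_contra hlt
  push Not at hlt
  let τ1 : G.MinStrategy :=
    { toFun := fun z => if z = x then y else τ.toFun z
      mem_succ := by
        intro z hz
        by_cases h : z = x
        · subst h; simpa using hy
        · simpa [h] using τ.mem_succ z hz
      eq_id := by
        intro z hz
        have h : z ≠ x := by rintro rfl; exact hz hx
        simpa [h] using τ.eq_id z hz }
  have hxM : x ∉ G.VMax := fun h => Finset.disjoint_left.1 G.disjMaxMin h hx
  have hpre : G.F σ τ1 (G.value σ τ) ≤ G.value σ τ := by
    intro z
    by_cases h : z = x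
    · subst h
      simpa [F, hxM, hx, τ1] using hlt.le
    · have h2 : G.F σ τ1 (G.value σ τ) z = G.F σ τ (G.value σ τ) z := by
        simp [F, τ1, h]
      rw [h2, G.value_fix]
  have heq : G.value σ τ1 = G.value σ τ :=
    le_antisymm (G.value_le_of _ _ _ hpre) (hbr τ1)
  have h3 := G.value_min σ τ1 hx
  rw [heq] at h3
  simp [τ1] at h3
  exact hlt.ne h3

/-- In a binary game, a vertex of the switch set has its chosen successor as the only
successor that is not strictly improving. -/
theorem switch_other (G : SSG V) (hbin : G.Binary) (σ : G.MaxStrategy) (τ : G.MinStrategy)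
    {x z : V} (hx : x ∈ G.switchSet σ τ) (hz : z ∈ G.succ x) (hne : z ≠ σ.toFun x) :
    G.value σ τ x < G.value σ τ z := by
  obtain ⟨hM, y, hy, hlt⟩ := hx
  have hys : y ≠ σ.toFun x := by
    rintro rfl
    exact hlt.ne (G.value_max σ τ hM).symm
  have : z = y := by
    obtain ⟨a, b, hab, h⟩ := Finset.card_eq_two.1 (hbin x hM)
    have hs := σ.mem_succ x hM
    rw [h] at hz hy hs
    simp only [Finset.mem_insert, Finset.mem_singleton] at hz hy hs
    grind
  rwa [this]

theorem value_le_aux (G : SSG V)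
    (hbin : G.Binary) (σ σ' : G.MaxStrategy) (τ τ' : G.MinStrategy)
    (hbr : G.IsBestResponse σ τ)
    (heq : G.switchSet σ τ = G.switchSet σ' τ') :
    G.value σ τ ≤ G.value σ' τ' := by
  classical
  by_contra hcon
  rw [Pi.le_def] at hcon
  push Not at hcon
  obtain ⟨x0, hx0⟩ := hcon
  let d : V → ℝ := fun x => (G.value σ τ x : ℝ) - (G.value σ' τ' x : ℝ)
  obtain ⟨m, -, hm⟩ := Finset.exists_max_image Finset.univ d ⟨x0, Finset.mem_univ _⟩
  have hle : ∀ x, d x ≤ d m := fun x => hm x (Finset.mem_univ _)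
  have hx0' : (G.value σ' τ' x0 : ℝ) < G.value σ τ x0 := hx0
  have hpos : 0 < d m := by
    have := hle x0
    simp only [d] at this ⊢
    linarith
  let u : V → unitInterval := fun x => if d x = d m then 0 else 1
  have hu : ∀ x, d x = d m → u x = 0 := fun x h => by simp [u, h]
  have hpre : G.F σ τ' u ≤ u := by
    intro x
    by_cases hxD : d x = d m
    swap
    · have : u x = 1 := by simp [u, hxD]
      rw [this]; exact unitInterval.le_one'
    suffices h : G.F σ τ' u x = 0 by rw [h]; exact unitInterval.nonneg'
    rcases G.cover x with hx | hx | hx | hx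
    · simp only [F, hx, dite_true]
      apply hu
      have e1 : (G.value σ τ (σ.toFun x) : ℝ) = G.value σ τ x :=
        congrArg _ (G.value_max σ τ hx)
      have e2 : (G.value σ' τ' (σ'.toFun x) : ℝ) = G.value σ' τ' x :=
        congrArg _ (G.value_max σ' τ' hx)
      by_cases hS : x ∈ G.switchSet σ τ
      · by_cases hs : σ'.toFun x = σ.toFun x
        · rw [hs] at e2
          simp only [d] at hxD ⊢
          linarith
        · exfalso
          have h1 : (G.value σ τ x : ℝ) < G.value σ τ (σ'.toFun x) :=
            G.switch_other hbin σ τ hS (σ'.mem_succ x hx) hs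
          have h2 := hle (σ'.toFun x)
          simp only [d] at hxD h2
          linarith
      · have hS' : x ∉ G.switchSet σ' τ' := heq ▸ hS
        have h1 : (G.value σ' τ' (σ.toFun x) : ℝ) ≤ G.value σ' τ' x := by
          by_contra hc
          push Not at hc
          exact hS' ⟨hx, _, σ.mem_succ x hx, hc⟩
        apply le_antisymm (hle _)
        simp only [d] at hxD ⊢
        linarith
    · have h1 : x ∉ G.VMax := fun h => Finset.disjoint_left.1 G.disjMaxMin h hx
      simp only [F, hx, h1, dite_true, dite_false]
      apply hu
      have e1 : (G.value σ τ x : ℝ) ≤ G.value σ τ (τ'.toFun x) :=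
        G.br_min σ τ hbr hx (τ'.mem_succ x hx)
      have e2 : (G.value σ' τ' (τ'.toFun x) : ℝ) = G.value σ' τ' x :=
        congrArg _ (G.value_min σ' τ' hx)
      apply le_antisymm (hle _)
      simp only [d] at hxD ⊢
      linarith
    · have h1 : x ∉ G.VMax := fun h => Finset.disjoint_left.1 G.disjMaxR h hx
      have h2 : x ∉ G.VMin := fun h => Finset.disjoint_left.1 G.disjMinR h hx
      have e1 := G.value_rand σ τ hx
      have e2 := G.value_rand σ' τ' hx
      have hsum : ∑ y, G.prob x y * (d m - d y) = 0 := by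
        have : ∑ y, G.prob x y * (d m - d y) = (∑ y, G.prob x y) * d m -
            (∑ y, G.prob x y * (G.value σ τ y : ℝ) -
              ∑ y, G.prob x y * (G.value σ' τ' y : ℝ)) := by
          rw [Finset.sum_mul, ← Finset.sum_sub_distrib, ← Finset.sum_sub_distrib]
          exact Finset.sum_congr rfl fun y _ => by simp only [d]; ring
        rw [this, G.prob_sum x hx, e1, e2, ← hxD]
        simp [d]
      have hz := (Finset.sum_eq_zero_iff_of_nonneg (fun y _ =>
        mul_nonneg (G.prob_nonneg x y) (sub_nonneg.2 (hle y)))).1 hsum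
      apply Subtype.ext
      simp only [F, hx, h1, h2, dite_true, dite_false]
      refine Finset.sum_eq_zero fun y hy => ?_
      rcases mul_eq_zero.1 (hz y hy) with h | h
      · simp [h]
      · rw [hu y (by linarith)]
        simp
    · exfalso
      have e1 := G.value_sink σ τ hx
      have e2 := G.value_sink σ' τ' hx
      simp only [d] at hxD hpos
      linarith
  have h0 : (G.value σ τ m : ℝ) ≤ 0 := by
    have := ((hbr τ').trans (G.value_le_of _ _ _ hpre)) m
    rw [hu m rfl] at this
    exact this
  have h1 := (G.value σ' τ' m).2.1
  simp only [d] at hpos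
  linarith

end SSG

/-- in a binary SSG, equal switch sets imply equal value vectors and equal
choices on the switch set. -/
theorem value_eq_of_switchSet_eq {V : Type*} [Fintype V] [DecidableEq V] (G : SSG V)
    (hbin : G.Binary) (σ σ' : G.MaxStrategy) (τ τ' : G.MinStrategy)
    (hbr : G.IsBestResponse σ τ) (hbr' : G.IsBestResponse σ' τ')
    (heq : G.switchSet σ τ = G.switchSet σ' τ') :
    G.value σ τ = G.value σ' τ' ∧ ∀ x ∈ G.switchSet σ τ, σ.toFun x = σ'.toFun x := by
  have hv : G.value σ τ = G.value σ' τ' :=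
    le_antisymm (G.value_le_aux hbin σ σ' τ τ' hbr heq)
      (G.value_le_aux hbin σ' σ τ' τ hbr' heq.symm)
  refine ⟨hv, fun x hx => ?_⟩
  by_contra hne
  have h1 := G.switch_other hbin σ τ hx (σ'.mem_succ x hx.1) (Ne.symm hne)
  rw [hv, G.value_max σ' τ' hx.1] at h1
  exact lt_irrefl _ h1
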